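/- For any measurable functions u: 𝒯 → ℝ and v: 𝒵 → ℝ such that u(T) and v(Z) are integrable and π_Z(T,Z)·u(T)·v(Z) is integrable, the covariate-balancing moment identity E[ π_Z(T, Z) · u(T) · v(Z) ] = E[u(T)] · E[v(Z)] holds. -/

import Mathlib

/-!
STATEMENT 1: For measurable `u : 𝒯 → ℝ` and `v : 𝒵 → ℝ` with `u(T)`, `v(Z)` and
`π_Z(T,Z)·u(T)·v(Z)` integrable, the covariate-balancing moment identity
`E[π_Z(T,Z)·u(T)·v(Z)] = E[u(T)]·E[v(Z)]` holds, where `π_Z(t,z) := f_T(t)/f_{T|Z}(t|z)`,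
`f_T` is the density of the law of `T` with respect to a σ-finite dominating measure `ν`
on `ℝ ⊇ 𝒯`, and `f_{T|Z}(·|z)` is a (strictly positive) conditional density of `T`
given `Z = z` with respect to the same `ν`.
-/

open MeasureTheory

noncomputable section

/-- Reweighting the joint law of `(T, Z)` by the ratio of the marginal density of `T` to its
conditional density given `Z` yields the product of the marginal laws. -/
theorem withDensity_stabilized_weight_eq_prod
    {Ω α β : Type*} [MeasurableSpace Ω] [MeasurableSpace α] [MeasurableSpace β]
    {P : Measure Ω} [SFinite P] {T : Ω → α} {Z : Ω → β}
    (hT : Measurable T) (hZ : Measurable Z) {ν : Measure α}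
    {fT : α → ℝ} {fTZ : α → β → ℝ} (hfT : Measurable fT)
    (hfTZ : Measurable fun p : α × β => fTZ p.1 p.2)
    (hfT_density : Measure.map T P = ν.withDensity fun t => ENNReal.ofReal (fT t))
    (hfTZ_density : ∀ g : α → β → ENNReal, Measurable (fun p : α × β => g p.1 p.2) →
      ∫⁻ ω, g (T ω) (Z ω) ∂P
        = ∫⁻ ω, ∫⁻ t, g t (Z ω) * ENNReal.ofReal (fTZ t (Z ω)) ∂ν ∂P)
    (hfTZ_pos : ∀ t z, 0 < fTZ t z) :
    (P.map fun ω => (T ω, Z ω)).withDensity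
        (fun p => ENNReal.ofReal (fT p.1 / fTZ p.1 p.2))
      = (P.map T).prod (P.map Z) := by
  have hw : Measurable fun p : α × β => ENNReal.ofReal (fT p.1 / fTZ p.1 p.2) :=
    ((hfT.comp measurable_fst).div hfTZ).ennreal_ofReal
  ext s hs
  have hh : Measurable (s.indicator (1 : α × β → ENNReal)) := measurable_one.indicator hs
  have hcancel (t : α) (z : β) :
      ENNReal.ofReal (fT t / fTZ t z) * s.indicator 1 (t, z) * ENNReal.ofReal (fTZ t z)
        = ENNReal.ofReal (fT t) * s.indicator 1 (t, z) := by
    rw [mul_right_comm, ← ENNReal.ofReal_mul' (hfTZ_pos t z).le,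
      div_mul_cancel₀ _ (hfTZ_pos t z).ne']
  calc (P.map fun ω => (T ω, Z ω)).withDensity
          (fun p => ENNReal.ofReal (fT p.1 / fTZ p.1 p.2)) s
      = ∫⁻ p, ENNReal.ofReal (fT p.1 / fTZ p.1 p.2) * s.indicator 1 p
          ∂(P.map fun ω => (T ω, Z ω)) := by
        rw [← lintegral_indicator_one hs, lintegral_withDensity_eq_lintegral_mul _ hw hh]
        rfl
    _ = ∫⁻ ω, ENNReal.ofReal (fT (T ω) / fTZ (T ω) (Z ω)) * s.indicator 1 (T ω, Z ω) ∂P :=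
        lintegral_map (hw.mul hh) (hT.prodMk hZ)
    _ = ∫⁻ ω, ∫⁻ t, ENNReal.ofReal (fT t) * s.indicator 1 (t, Z ω) ∂ν ∂P := by
        rw [hfTZ_density
          (fun t z => ENNReal.ofReal (fT t / fTZ t z) * s.indicator 1 (t, z)) (hw.mul hh)]
        simp_rw [hcancel]
    _ = ∫⁻ ω, ∫⁻ t, s.indicator 1 (t, Z ω) ∂(P.map T) ∂P := by
        refine lintegral_congr fun ω => ?_
        rw [hfT_density]
        exact (lintegral_withDensity_eq_lintegral_mul _ hfT.ennreal_ofReal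
          (hh.comp measurable_prodMk_right)).symm
    _ = ∫⁻ z, ∫⁻ t, s.indicator 1 (t, z) ∂(P.map T) ∂(P.map Z) :=
        (lintegral_map hh.lintegral_prod_left' hZ).symm
    _ = (P.map T).prod (P.map Z) s := by
        rw [← lintegral_prod_symm' _ hh, lintegral_indicator_one hs]

theorem covariate_balancing_moment_identity
    {Ω : Type*} [MeasurableSpace Ω] (P : Measure Ω) [IsProbabilityMeasure P]
    (d : ℕ)
    (T : Ω → ℝ) (Z : Ω → (Fin d → ℝ)) (hT : Measurable T) (hZ : Measurable Z)
    (ν : Measure ℝ) [SigmaFinite ν]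
    (fT : ℝ → ℝ) (fTZ : ℝ → (Fin d → ℝ) → ℝ)
    (hfT : Measurable fT) (hfTZ : Measurable fun p : ℝ × (Fin d → ℝ) => fTZ p.1 p.2)
    -- `fT` is the density of the law of `T` with respect to `ν`
    (hfT_density : Measure.map T P = ν.withDensity fun t => ENNReal.ofReal (fT t))
    -- `fTZ (·|z)` is a conditional density of `T` given `Z = z` with respect to `ν`:
    -- the joint law of `(T, Z)` disintegrates over the law of `Z` with density `fTZ` in `t`
    (hfTZ_density : ∀ g : ℝ → (Fin d → ℝ) → ENNReal,
      Measurable (fun p : ℝ × (Fin d → ℝ) => g p.1 p.2) →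
      ∫⁻ ω, g (T ω) (Z ω) ∂P
        = ∫⁻ ω, ∫⁻ t, g t (Z ω) * ENNReal.ofReal (fTZ t (Z ω)) ∂ν ∂P)
    -- strict positivity of the conditional density
    (hfTZ_pos : ∀ t z, 0 < fTZ t z)
    -- the stabilized weight
    (πZ : ℝ → (Fin d → ℝ) → ℝ) (hπZ : ∀ t z, πZ t z = fT t / fTZ t z)
    (u : ℝ → ℝ) (v : (Fin d → ℝ) → ℝ) (hu : Measurable u) (hv : Measurable v)
    (huT : Integrable (fun ω => u (T ω)) P)
    (hvZ : Integrable (fun ω => v (Z ω)) P)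
    (hπuv : Integrable (fun ω => πZ (T ω) (Z ω) * u (T ω) * v (Z ω)) P) :
    ∫ ω, πZ (T ω) (Z ω) * u (T ω) * v (Z ω) ∂P
      = (∫ ω, u (T ω) ∂P) * (∫ ω, v (Z ω) ∂P) := by
  have hw : Measurable fun p : ℝ × (Fin d → ℝ) => (fT p.1 / fTZ p.1 p.2).toNNReal :=
    ((hfT.comp measurable_fst).div hfTZ).real_toNNReal
  have hneg : ∀ᵐ ω ∂P, 0 ≤ fT (T ω) := by
    refine ae_of_ae_map hT.aemeasurable (p := fun t => 0 ≤ fT t) ?_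
    rw [hfT_density, ae_withDensity_iff hfT.ennreal_ofReal]
    refine .of_forall fun t ht => ?_
    by_contra! h
    exact ht (ENNReal.ofReal_of_nonpos h.le)
  calc ∫ ω, πZ (T ω) (Z ω) * u (T ω) * v (Z ω) ∂P
      = ∫ ω, (fT (T ω) / fTZ (T ω) (Z ω)).toNNReal • (u (T ω) * v (Z ω)) ∂P := by
        refine integral_congr_ae ?_
        filter_upwards [hneg] with ω hω
        rw [NNReal.smul_def, Real.coe_toNNReal _ (div_nonneg hω (hfTZ_pos _ _).le),
          smul_eq_mul, hπZ, mul_assoc]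
    _ = ∫ p, (fT p.1 / fTZ p.1 p.2).toNNReal • (u p.1 * v p.2)
          ∂(P.map fun ω => (T ω, Z ω)) := by
        refine (integral_map (hT.prodMk hZ).aemeasurable
          (f := fun p => (fT p.1 / fTZ p.1 p.2).toNNReal • (u p.1 * v p.2)) ?_).symm
        exact (hw.smul ((hu.comp measurable_fst).mul
          (hv.comp measurable_snd))).aestronglyMeasurable
    _ = ∫ p, u p.1 * v p.2 ∂((P.map T).prod (P.map Z)) := by
        rw [← withDensity_stabilized_weight_eq_prod hT hZ hfT hfTZ hfT_density hfTZ_density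
          hfTZ_pos]
        exact (integral_withDensity_eq_integral_smul hw _).symm
    _ = (∫ ω, u (T ω) ∂P) * (∫ ω, v (Z ω) ∂P) := by
        rw [integral_prod_mul, integral_map hT.aemeasurable hu.aestronglyMeasurable,
          integral_map hZ.aemeasurable hv.aestronglyMeasurable]
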